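/- For t > 0 and X, Y ∈ ℝ^d with π(X)π(Y) ≠ 0, define p_t^W(X,Y) = (|W| (4πt)^{d/2} π(X) π(Y))^{−1} ∑_{w∈W} det(w) exp(−|X − wY|²/(4t)). Then: (i) for each fixed non-singular Y, the function (t, X) ↦ p_t^W(X,Y) satisfies the W-invariant heat equation ∂_t p_t^W(X,Y) = π(X)^{−1} · Δ_X(π(·) p_t^W(·, Y))(X) at every t > 0 and non-singular X, where Δ is the Euclidean Laplacian on ℝ^d; (ii) for every bounded continuous W-invariant function f : ℝ^d → ℝ (f(wY) = f(Y) for all w ∈ W) and every non-singular X, lim_{t→0⁺} ∫_{ℝ^d} p_t^W(X,Y) f(Y) π(Y)² dY = f(X), the integrand being defined for almost every Y. -/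

import Mathlib

open scoped BigOperators RealInnerProductSpace Classical
open Finset

noncomputable section

/-- Euclidean space `ℝ^d`. -/
abbrev E (d : ℕ) := EuclideanSpace ℝ (Fin d)

/-- The reflection `s_α x = x - 2 (⟪α, x⟫/⟪α, α⟫) α` fixing the hyperplane `α^⊥`. -/
def reflVec {d : ℕ} (α x : E d) : E d := x - (2 * ⟪α, x⟫ / ⟪α, α⟫) • α

/-- `Sig` is a reduced root system in `ℝ^d`: a finite set of nonzero vectors spanning `ℝ^d`,
with `Sig ∩ ℝα = {α, -α}` and `s_α (Sig) = Sig` for all `α ∈ Sig`. -/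
def IsRootSystem {d : ℕ} (Sig : Finset (E d)) : Prop :=
  (0 : E d) ∉ Sig ∧
  Submodule.span ℝ (Sig : Set (E d)) = ⊤ ∧
  (∀ α ∈ Sig, ∀ t : ℝ, t • α ∈ Sig → t = 1 ∨ t = -1) ∧
  (∀ α ∈ Sig, ∀ β ∈ Sig, reflVec α β ∈ Sig)

/-- `Sp` is a positive system for `Sig`: `Sp = {α ∈ Sig : ⟪α, v⟫ > 0}` for a vector `v` not
orthogonal to any root. -/
def IsPositiveSystem {d : ℕ} (Sig Sp : Finset (E d)) : Prop :=
  ∃ v : E d, (∀ α ∈ Sig, ⟪α, v⟫ ≠ 0) ∧ ∀ α : E d, α ∈ Sp ↔ α ∈ Sig ∧ 0 < ⟪α, v⟫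

/-- The Weyl group of `Sig`: the subgroup of the orthogonal group of `ℝ^d` generated by the
reflections `s_α`, `α ∈ Sig`. -/
def weylGroup {d : ℕ} (Sig : Finset (E d)) : Subgroup (E d ≃ₗᵢ[ℝ] E d) :=
  Subgroup.closure {w : E d ≃ₗᵢ[ℝ] E d | ∃ α ∈ Sig, ∀ x : E d, w x = reflVec α x}

/-- Determinant of an orthogonal transformation (`±1`). -/
def dsign {d : ℕ} (w : E d ≃ₗᵢ[ℝ] E d) : ℝ := LinearMap.det (w.toLinearEquiv.toLinearMap)

/-- `π(X) = ∏_{α ∈ Sp} ⟪α, X⟫`. -/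
def piP {d : ℕ} (Sp : Finset (E d)) (X : E d) : ℝ := ∏ α ∈ Sp, ⟪α, X⟫

/-- The Euclidean Laplacian on `ℝ^d`, as the sum of the second partial derivatives. -/
def lapl {d : ℕ} (f : E d → ℝ) (X : E d) : ℝ :=
  ∑ i : Fin d,
    fderiv ℝ (fun Z => fderiv ℝ f Z (EuclideanSpace.single i 1)) X (EuclideanSpace.single i 1)

/-- The `W`-invariant heat kernel
`p_t^W(X,Y) = (|W| (4πt)^{d/2} π(X) π(Y))⁻¹ ∑_{w∈W} det(w) exp(-|X - wY|²/(4t))`. -/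
def heatK {d : ℕ} (Sig Sp : Finset (E d)) [Fintype ↥(weylGroup Sig)]
    (t : ℝ) (X Y : E d) : ℝ :=
  ((Fintype.card ↥(weylGroup Sig) : ℝ) * (4 * Real.pi * t) ^ ((d : ℝ) / 2) *
      piP Sp X * piP Sp Y)⁻¹ *
    ∑ w : ↥(weylGroup Sig), dsign w.1 * Real.exp (-‖X - w.1 Y‖ ^ 2 / (4 * t))

section Weyl

variable {d : ℕ}

lemma inner_reflVec_comm (α x y : E d) : ⟪x, reflVec α y⟫ = ⟪reflVec α x, y⟫ := by
  simp only [reflVec, inner_sub_left, inner_sub_right, real_inner_smul_left,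
    real_inner_smul_right, real_inner_comm x α]
  ring

lemma reflVec_self {α : E d} (hα : α ≠ 0) : reflVec α α = -α := by
  have h : ⟪α, α⟫ ≠ 0 := inner_self_ne_zero.mpr hα
  rw [reflVec, mul_div_cancel_right₀ _ h, two_smul]
  abel

lemma reflVec_neg_left (α x : E d) : reflVec (-α) x = reflVec α x := by
  simp [reflVec, neg_div]

lemma reflVec_reflVec {α : E d} (hα : α ≠ 0) (x : E d) : reflVec α (reflVec α x) = x := by
  have h : ⟪α, α⟫ ≠ 0 := inner_self_ne_zero.mpr hα
  have h1 : ⟪α, reflVec α x⟫ = -⟪α, x⟫ := by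
    rw [inner_reflVec_comm, reflVec_self hα, inner_neg_left]
  rw [reflVec, h1, reflVec, sub_sub, ← add_smul]
  simp [neg_div]

lemma reflVec_neg_right (α x : E d) : reflVec α (-x) = -reflVec α x := by
  simp only [reflVec, inner_neg_right, mul_neg, neg_div, neg_smul]
  abel

lemma dsign_of_eq_reflVec {α : E d} (hα : α ≠ 0) {w : E d ≃ₗᵢ[ℝ] E d}
    (hw : ∀ x, w x = reflVec α x) : dsign w = -1 := by
  have h : w = (ℝ ∙ α)ᗮ.reflection := by
    ext1 x
    rw [hw, Submodule.reflection_orthogonal_apply, Submodule.reflection_singleton_apply, reflVec,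
      real_inner_self_eq_norm_sq]
    simp only [RCLike.ofReal_real_eq_id, id_eq, neg_sub, sub_right_inj]
    rw [mul_div_assoc, two_smul, two_mul, add_smul]
  rw [dsign, h]
  refine (Submodule.det_reflection _).trans ?_
  rw [Submodule.orthogonal_orthogonal, finrank_span_singleton hα, pow_one]

variable {Sig Sp : Finset (E d)}

lemma IsRootSystem.ne_zero (hroot : IsRootSystem Sig) {α : E d} (hα : α ∈ Sig) : α ≠ 0 :=
  fun h => hroot.1 (h ▸ hα)

lemma IsRootSystem.neg_mem (hroot : IsRootSystem Sig) {α : E d} (hα : α ∈ Sig) : -α ∈ Sig := by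
  rw [← reflVec_self (hroot.ne_zero hα)]
  exact hroot.2.2.2 α hα α hα

lemma IsPositiveSystem.subset (hpos : IsPositiveSystem Sig Sp) {α : E d} (hα : α ∈ Sp) :
    α ∈ Sig := by
  obtain ⟨v, -, h⟩ := hpos
  exact ((h α).1 hα).1

lemma IsPositiveSystem.mem_or_neg_mem (hroot : IsRootSystem Sig) (hpos : IsPositiveSystem Sig Sp)
    {α : E d} (hα : α ∈ Sig) : α ∈ Sp ∨ -α ∈ Sp := by
  obtain ⟨v, hv, h⟩ := hpos
  rcases (hv α hα).lt_or_gt with h' | h'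
  · exact Or.inr ((h _).2 ⟨hroot.neg_mem hα, by rw [inner_neg_left]; linarith⟩)
  · exact Or.inl ((h _).2 ⟨hα, h'⟩)

lemma IsPositiveSystem.neg_notMem (hpos : IsPositiveSystem Sig Sp)
    {α : E d} (hα : α ∈ Sp) : -α ∉ Sp := by
  obtain ⟨v, hv, h⟩ := hpos
  intro h'
  have h1 := ((h _).1 hα).2
  have h2 := ((h _).1 h').2
  rw [inner_neg_left] at h2
  linarith

/-- The reflection in a positive root changes the sign of an even number of other positive
roots. -/
lemma prod_erase_inner_reflVec (hroot : IsRootSystem Sig) (hpos : IsPositiveSystem Sig Sp)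
    {α : E d} (hα : α ∈ Sp) (Y : E d) :
    ∏ β ∈ Sp.erase α, ⟪β, reflVec α Y⟫ = ∏ β ∈ Sp.erase α, ⟪β, Y⟫ := by
  have hαS := hpos.subset hα
  have hα0 := hroot.ne_zero hαS
  have hS : ∀ β ∈ Sp, reflVec α β ∈ Sig := fun β hβ => hroot.2.2.2 α hαS β (hpos.subset hβ)
  simp only [inner_reflVec_comm]
  rw [← prod_filter_mul_prod_filter_not (Sp.erase α) (fun β => reflVec α β ∈ Sp),
    ← prod_filter_mul_prod_filter_not (Sp.erase α) (fun β => reflVec α β ∈ Sp)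
      (fun β => ⟪β, Y⟫)]
  have hN : ∀ β ∈ {β ∈ Sp.erase α | reflVec α β ∉ Sp},
      -reflVec α β ∈ {β ∈ Sp.erase α | reflVec α β ∉ Sp} := by
    intro β hβ
    simp only [mem_filter, mem_erase] at hβ ⊢
    obtain ⟨⟨h1, h2⟩, h3⟩ := hβ
    refine ⟨⟨fun h => ?_, (hpos.mem_or_neg_mem hroot (hS β h2)).resolve_left h3⟩, ?_⟩
    · rw [← reflVec_neg_right, ← reflVec_reflVec hα0 (-β)] at h
      have h4 := congrArg (reflVec α) h
      rw [reflVec_reflVec hα0, reflVec_reflVec hα0, reflVec_self hα0] at h4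
      exact h1 (neg_injective h4)
    · rw [reflVec_neg_right, reflVec_reflVec hα0]
      exact hpos.neg_notMem h2
  congr 1
  · refine prod_nbij' (reflVec α) (reflVec α) ?_ ?_ (fun _ _ => reflVec_reflVec hα0 _)
      (fun _ _ => reflVec_reflVec hα0 _) (fun _ _ => rfl) <;>
    · intro β hβ
      simp only [mem_filter, mem_erase] at hβ ⊢
      obtain ⟨⟨h1, h2⟩, h3⟩ := hβ
      refine ⟨⟨fun h => ?_, h3⟩, by rwa [reflVec_reflVec hα0]⟩
      have h4 := congrArg (reflVec α) h
      rw [reflVec_reflVec hα0, reflVec_self hα0] at h4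
      exact hpos.neg_notMem hα (h4 ▸ h2)
  · have hsign : ∏ β ∈ {β ∈ Sp.erase α | reflVec α β ∉ Sp}, (-1 : ℝ) = 1 := by
      refine prod_involution (fun β _ => -reflVec α β) (fun _ _ => by norm_num) ?_ hN ?_
      · intro β hβ _ h
        simp only [mem_filter, mem_erase] at hβ
        have h2 : (2 : ℝ) • β = (2 * ⟪α, β⟫ / ⟪α, α⟫) • α := by
          rw [reflVec, neg_sub, sub_eq_iff_eq_add] at h
          rw [h, two_smul]
        have h3 : β = (⟪α, β⟫ / ⟪α, α⟫) • α := by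
          have := congrArg (fun z => (2⁻¹ : ℝ) • z) h2
          simp only [smul_smul] at this
          rw [inv_mul_cancel₀ two_ne_zero, one_smul] at this
          rw [this]
          congr 1
          rw [← this]
          ring
        have h4 := hpos.subset hβ.1.2
        rw [h3] at h4
        rcases hroot.2.2.1 α hαS _ h4 with h5 | h5
        · rw [h5, one_smul] at h3
          exact hβ.1.1 h3
        · rw [h5, neg_one_smul] at h3
          exact hpos.neg_notMem hα (h3 ▸ hβ.1.2)
      · intro β hβ
        rw [reflVec_neg_right, neg_neg, reflVec_reflVec hα0]
    calc _ = ∏ β ∈ {β ∈ Sp.erase α | reflVec α β ∉ Sp}, (-1) * ⟪-reflVec α β, Y⟫ :=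
          prod_congr rfl fun β _ => by rw [inner_neg_left]; ring
      _ = ∏ β ∈ {β ∈ Sp.erase α | reflVec α β ∉ Sp}, ⟪-reflVec α β, Y⟫ := by
          rw [prod_mul_distrib, hsign, one_mul]
      _ = _ := by
          refine prod_nbij' (fun β => -reflVec α β) (fun β => -reflVec α β) hN hN ?_ ?_
            (fun _ _ => rfl) <;>
          · intro β _
            rw [reflVec_neg_right, neg_neg, reflVec_reflVec hα0]

lemma piP_reflVec (hroot : IsRootSystem Sig) (hpos : IsPositiveSystem Sig Sp)
    {α : E d} (hα : α ∈ Sig) (Y : E d) : piP Sp (reflVec α Y) = -piP Sp Y := by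
  wlog h : α ∈ Sp generalizing α
  · rw [← reflVec_neg_left]
    exact this (hroot.neg_mem hα) ((hpos.mem_or_neg_mem hroot hα).resolve_left h)
  rw [piP, piP, ← mul_prod_erase _ _ h, ← mul_prod_erase _ _ h,
    prod_erase_inner_reflVec hroot hpos h, inner_reflVec_comm, reflVec_self (hroot.ne_zero hα),
    inner_neg_left, neg_mul]

lemma dsign_mul (w₁ w₂ : E d ≃ₗᵢ[ℝ] E d) : dsign (w₁ * w₂) = dsign w₁ * dsign w₂ :=
  LinearMap.det_comp w₁.toLinearEquiv.toLinearMap w₂.toLinearEquiv.toLinearMap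

/-- The product of the positive roots is anti-invariant under the Weyl group. -/
lemma piP_weylGroup (hroot : IsRootSystem Sig) (hpos : IsPositiveSystem Sig Sp)
    {w : E d ≃ₗᵢ[ℝ] E d} (hw : w ∈ weylGroup Sig) (Y : E d) :
    piP Sp (w Y) = dsign w * piP Sp Y := by
  induction hw using Subgroup.closure_induction generalizing Y with
  | mem w hw =>
    obtain ⟨α, hα, h⟩ := hw
    rw [h, dsign_of_eq_reflVec (hroot.ne_zero hα) h, piP_reflVec hroot hpos hα, neg_one_mul]
  | one =>
    have : dsign (1 : E d ≃ₗᵢ[ℝ] E d) = 1 := LinearMap.det_id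
    rw [this, one_mul]
    rfl
  | mul x y _ _ hx hy => rw [dsign_mul, mul_assoc, ← hy, ← hx]; rfl
  | inv x _ hx =>
    have h1 := hx (x⁻¹ Y)
    have h2 : x (x⁻¹ Y) = Y := x.apply_symm_apply Y
    have h3 : dsign x * dsign x⁻¹ = 1 := by
      rw [← dsign_mul, mul_inv_cancel]
      exact LinearMap.det_id
    rw [h2] at h1
    rw [h1, ← mul_assoc, mul_comm (dsign x⁻¹), h3, one_mul]

lemma IsPositiveSystem.piP_ne_zero (hpos : IsPositiveSystem Sig Sp) {X : E d}
    (hX : ∀ α ∈ Sig, ⟪α, X⟫ ≠ 0) : piP Sp X ≠ 0 :=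
  prod_ne_zero_iff.2 fun α hα => hX α (hpos.subset hα)

end Weyl

section Analysis

open MeasureTheory Filter Topology

variable {d : ℕ}

lemma integrable_exp_neg_mul_sq_norm {b : ℝ} (hb : 0 < b) :
    Integrable fun Z : E d => Real.exp (-b * ‖Z‖ ^ 2) := by
  refine Integrable.of_integral_ne_zero ?_
  rw [GaussianFourier.integral_rexp_neg_mul_sq_norm hb]
  positivity

lemma integrable_exp_neg_mul_sq_norm_mul_exp {b : ℝ} (hb : 0 < b) :
    Integrable fun Z : E d => Real.exp (-b * ‖Z‖ ^ 2) * Real.exp ‖Z‖ := by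
  refine ((integrable_exp_neg_mul_sq_norm (half_pos hb)).const_mul (Real.exp (1 / (2 * b)))).mono'
    (by fun_prop) (ae_of_all _ fun Z => ?_)
  rw [Real.norm_of_nonneg (by positivity), ← Real.exp_add, ← Real.exp_add, Real.exp_le_exp]
  have h : 1 / (2 * b) + -(b / 2) * ‖Z‖ ^ 2 - (-b * ‖Z‖ ^ 2 + ‖Z‖)
      = (b * ‖Z‖ - 1) ^ 2 / (2 * b) := by
    field_simp
    ring
  have h' : 0 ≤ (b * ‖Z‖ - 1) ^ 2 / (2 * b) := by positivity
  linarith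

lemma abs_add_smul_le {h : E d → ℝ} {C : ℝ} (hC : ∀ Y, |h Y| ≤ C * Real.exp ‖Y‖) (X Z : E d)
    {s : ℝ} (hs : |s| ≤ 1) : |h (X + s • Z)| ≤ C * Real.exp ‖X‖ * Real.exp ‖Z‖ := by
  have hC0 : 0 ≤ C := by simpa using (abs_nonneg _).trans (hC 0)
  refine (hC _).trans ?_
  rw [mul_assoc, ← Real.exp_add]
  gcongr
  refine (norm_add_le _ _).trans ?_
  rw [norm_smul, Real.norm_eq_abs]
  gcongr
  exact mul_le_of_le_one_left (norm_nonneg _) hs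

lemma integrable_gaussian_mul {h : E d → ℝ} (hh : Continuous h) {C : ℝ}
    (hC : ∀ Y, |h Y| ≤ C * Real.exp ‖Y‖) (X : E d) {t : ℝ} (ht : 0 < t) :
    Integrable fun Y => Real.exp (-‖X - Y‖ ^ 2 / (4 * t)) * h Y := by
  have key : Integrable fun Z => Real.exp (-‖X - (X + Z)‖ ^ 2 / (4 * t)) * h (X + Z) := by
    refine ((integrable_exp_neg_mul_sq_norm_mul_exp (d := d) (b := 1 / (4 * t))
      (by positivity)).const_mul (C * Real.exp ‖X‖)).mono' (by fun_prop)
      (ae_of_all _ fun Z => ?_)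
    rw [norm_mul, Real.norm_of_nonneg (Real.exp_pos _).le, Real.norm_eq_abs, sub_add_cancel_left,
      norm_neg, mul_left_comm, show -(1 / (4 * t)) * ‖Z‖ ^ 2 = -‖Z‖ ^ 2 / (4 * t) by ring]
    gcongr
    simpa using abs_add_smul_le hC X Z (s := 1) (by simp)
  simpa using key.comp_add_left (-X)

/-- The Euclidean heat kernel is an approximate identity on continuous functions of at most
exponential growth. -/
lemma tendsto_integral_gaussian_mul {h : E d → ℝ} (hh : Continuous h) {C : ℝ}
    (hC : ∀ Y, |h Y| ≤ C * Real.exp ‖Y‖) (X : E d) :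
    Tendsto (fun t : ℝ => ((4 * Real.pi * t) ^ ((d : ℝ) / 2))⁻¹ *
      ∫ Y, Real.exp (-‖X - Y‖ ^ 2 / (4 * t)) * h Y) (𝓝[>] 0) (𝓝 (h X)) := by
  have hd : Module.finrank ℝ (E d) = d := by simp
  have hlim : Tendsto (fun t : ℝ => ∫ Z, Real.exp (-(1 / 4) * ‖Z‖ ^ 2) * h (X + √t • Z)) (𝓝[>] 0)
      (𝓝 (∫ Z : E d, Real.exp (-(1 / 4) * ‖Z‖ ^ 2) * h X)) := by
    refine tendsto_integral_filter_of_dominated_convergence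
      (fun Z => C * Real.exp ‖X‖ * (Real.exp (-(1 / 4) * ‖Z‖ ^ 2) * Real.exp ‖Z‖))
      (Eventually.of_forall fun t => by fun_prop) ?_
      ((integrable_exp_neg_mul_sq_norm_mul_exp (by norm_num)).const_mul _)
      (ae_of_all _ fun Z => ?_)
    · filter_upwards [Ioo_mem_nhdsGT one_pos] with t ht
      refine ae_of_all _ fun Z => ?_
      rw [norm_mul, Real.norm_of_nonneg (Real.exp_pos _).le, Real.norm_eq_abs, mul_left_comm]
      gcongr
      refine abs_add_smul_le hC X Z ?_
      rw [abs_of_nonneg (Real.sqrt_nonneg _)]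
      exact Real.sqrt_le_one.2 ht.2.le
    · have hc : Continuous fun t : ℝ => Real.exp (-(1 / 4) * ‖Z‖ ^ 2) * h (X + √t • Z) := by
        fun_prop
      simpa using (hc.tendsto 0).mono_left nhdsWithin_le_nhds
  rw [integral_mul_const, GaussianFourier.integral_rexp_neg_mul_sq_norm (by norm_num), hd] at hlim
  have hpos : 0 < (Real.pi / (1 / 4)) ^ ((d : ℝ) / 2) := by positivity
  have hlim' := hlim.const_mul ((Real.pi / (1 / 4)) ^ ((d : ℝ) / 2))⁻¹
  rw [inv_mul_cancel_left₀ hpos.ne'] at hlim'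
  refine hlim'.congr' ?_
  filter_upwards [self_mem_nhdsWithin] with t ht
  have ht : 0 < t := ht
  have hs : 0 < √t := Real.sqrt_pos.2 ht
  have hsub := Measure.integral_comp_smul (volume : Measure (E d))
    (fun Z => Real.exp (-‖X - (X + Z)‖ ^ 2 / (4 * t)) * h (X + Z)) (√t)
  rw [integral_add_left_eq_self (fun Y => Real.exp (-‖X - Y‖ ^ 2 / (4 * t)) * h Y) X, hd,
    abs_of_nonneg (by positivity), smul_eq_mul] at hsub
  have hint : ∀ Z : E d, Real.exp (-‖X - (X + √t • Z)‖ ^ 2 / (4 * t)) * h (X + √t • Z)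
      = Real.exp (-(1 / 4) * ‖Z‖ ^ 2) * h (X + √t • Z) := by
    intro Z
    congr 2
    rw [sub_add_cancel_left, norm_neg, norm_smul, Real.norm_of_nonneg hs.le, mul_pow,
      Real.sq_sqrt ht.le]
    field_simp
  simp only [hint] at hsub
  rw [hsub, ← mul_assoc]
  congr 1
  rw [← mul_inv, show 4 * Real.pi * t = Real.pi / (1 / 4) * t by ring,
    Real.mul_rpow (by positivity) ht.le, ← Real.rpow_natCast √t, Real.sqrt_eq_rpow,
    ← Real.rpow_mul ht.le]
  congr 3
  ring

lemma continuous_piP (Sp : Finset (E d)) : Continuous (piP Sp) := by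
  unfold piP
  fun_prop

lemma abs_piP_le (Sp : Finset (E d)) : ∃ C, ∀ Y, |piP Sp Y| ≤ C * Real.exp ‖Y‖ := by
  refine ⟨(∏ α ∈ Sp, ‖α‖) * (Sp.card.factorial : ℝ), fun Y => ?_⟩
  have h := Real.pow_div_factorial_le_exp _ (norm_nonneg Y) Sp.card
  rw [div_le_iff₀ (by positivity)] at h
  rw [piP, abs_prod, mul_assoc, mul_comm (Sp.card.factorial : ℝ)]
  calc _ ≤ ∏ α ∈ Sp, ‖α‖ * ‖Y‖ :=
        prod_le_prod (fun _ _ => abs_nonneg _) fun α _ => abs_real_inner_le_norm α Y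
    _ = (∏ α ∈ Sp, ‖α‖) * ‖Y‖ ^ Sp.card := by rw [prod_mul_distrib, prod_const]
    _ ≤ _ := by gcongr

lemma hasFDerivAt_gaussian (a : E d) (t : ℝ) (Z : E d) :
    HasFDerivAt (fun Z => Real.exp (-‖Z - a‖ ^ 2 / (4 * t)))
      ((-Real.exp (-‖Z - a‖ ^ 2 / (4 * t)) / (2 * t)) • innerSL ℝ (Z - a)) Z := by
  have h := (((hasStrictFDerivAt_norm_sq (Z - a)).hasFDerivAt.comp Z
    ((hasFDerivAt_id Z).sub_const a)).neg.mul_const (4 * t)⁻¹).exp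
  refine (h.congr_fderiv ?_).congr_of_eventuallyEq (Eventually.of_forall fun Y => ?_)
  · ext v
    simp [div_eq_mul_inv]
    ring
  · simp [div_eq_mul_inv]

lemma hasFDerivAt_fderiv_gaussian_apply (a e : E d) (t : ℝ) (Z : E d) :
    HasFDerivAt (fun Z => (-Real.exp (-‖Z - a‖ ^ 2 / (4 * t)) / (2 * t)) * ⟪e, Z - a⟫)
      ((Real.exp (-‖Z - a‖ ^ 2 / (4 * t)) * ⟪e, Z - a⟫ / (4 * t ^ 2)) • innerSL ℝ (Z - a)
        - (Real.exp (-‖Z - a‖ ^ 2 / (4 * t)) / (2 * t)) • innerSL ℝ e) Z := by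
  have h := ((hasFDerivAt_gaussian a t Z).neg.mul_const (2 * t)⁻¹).mul
    ((innerSL ℝ e).hasFDerivAt.comp Z ((hasFDerivAt_id Z).sub_const a))
  refine (h.congr_fderiv ?_).congr_of_eventuallyEq (Eventually.of_forall fun Y => ?_)
  · ext v
    simp [div_eq_mul_inv]
    ring
  · simp [div_eq_mul_inv]

/-- The Laplacian of a linear combination of Gaussians. -/
lemma lapl_sum_gaussian {ι : Type*} (s : Finset ι) (c : ι → ℝ) (a : ι → E d) (t : ℝ)
    (X : E d) :
    lapl (fun Z => ∑ i ∈ s, c i * Real.exp (-‖Z - a i‖ ^ 2 / (4 * t))) X =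
      ∑ i ∈ s, c i * ((‖X - a i‖ ^ 2 / (4 * t ^ 2) - d / (2 * t)) *
        Real.exp (-‖X - a i‖ ^ 2 / (4 * t))) := by
  have h1 : ∀ e Z, fderiv ℝ (fun Z => ∑ i ∈ s, c i * Real.exp (-‖Z - a i‖ ^ 2 / (4 * t))) Z e =
      ∑ i ∈ s, c i * ((-Real.exp (-‖Z - a i‖ ^ 2 / (4 * t)) / (2 * t)) * ⟪e, Z - a i⟫) := by
    intro e Z
    rw [(HasFDerivAt.fun_sum fun i _ =>
      (hasFDerivAt_gaussian (a i) t Z).const_mul (c i)).fderiv]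
    simp [real_inner_comm e, inner_sub_right]
  have h2 : ∀ e, fderiv ℝ (fun Z => ∑ i ∈ s,
      c i * ((-Real.exp (-‖Z - a i‖ ^ 2 / (4 * t)) / (2 * t)) * ⟪e, Z - a i⟫)) X e =
      ∑ i ∈ s, c i * (Real.exp (-‖X - a i‖ ^ 2 / (4 * t)) * ⟪e, X - a i⟫ ^ 2 / (4 * t ^ 2)
        - Real.exp (-‖X - a i‖ ^ 2 / (4 * t)) / (2 * t) * ‖e‖ ^ 2) := by
    intro e
    rw [(HasFDerivAt.fun_sum fun i _ =>
      (hasFDerivAt_fderiv_gaussian_apply (a i) e t X).const_mul (c i)).fderiv]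
    simp only [_root_.sum_apply, smul_apply, sub_apply, innerSL_apply_apply, smul_eq_mul,
      real_inner_self_eq_norm_sq]
    refine sum_congr rfl fun i _ => ?_
    rw [real_inner_comm]
    ring
  simp only [lapl, h1, h2]
  rw [sum_comm]
  refine sum_congr rfl fun i _ => ?_
  rw [← mul_sum, sum_sub_distrib, ← sum_div, ← mul_sum]
  have h3 : ∑ j : Fin d, ⟪EuclideanSpace.single j (1 : ℝ), X - a i⟫ ^ 2 = ‖X - a i‖ ^ 2 := by
    rw [EuclideanSpace.real_norm_sq_eq]
    simp [EuclideanSpace.inner_single_left]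
  rw [h3]
  simp only [PiLp.norm_single, norm_one, one_pow, sum_const, card_univ, Fintype.card_fin,
    nsmul_eq_mul, mul_one]
  ring

lemma hasDerivAt_gaussian_time (d : ℕ) (r : ℝ) {t : ℝ} (ht : 0 < t) :
    HasDerivAt (fun s : ℝ => ((4 * Real.pi * s) ^ ((d : ℝ) / 2))⁻¹ * Real.exp (-r / (4 * s)))
      (((4 * Real.pi * t) ^ ((d : ℝ) / 2))⁻¹ *
        ((r / (4 * t ^ 2) - d / (2 * t)) * Real.exp (-r / (4 * t)))) t := by
  have hA : (0 : ℝ) < 4 * Real.pi * t := by positivity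
  have hP : (0 : ℝ) < (4 * Real.pi * t) ^ ((d : ℝ) / 2) := by positivity
  have h1 : HasDerivAt (fun s : ℝ => ((4 * Real.pi * s) ^ ((d : ℝ) / 2))⁻¹)
      (-(d / (2 * t)) * ((4 * Real.pi * t) ^ ((d : ℝ) / 2))⁻¹) t := by
    have := (((hasDerivAt_id t).const_mul (4 * Real.pi)).rpow_const (p := (d : ℝ) / 2)
      (Or.inl hA.ne')).inv hP.ne'
    refine this.congr_deriv ?_
    simp only [id]
    rw [Real.rpow_sub_one hA.ne']
    field_simp
  have h2 : HasDerivAt (fun s : ℝ => Real.exp (-r / (4 * s)))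
      (Real.exp (-r / (4 * t)) * (r / (4 * t ^ 2))) t := by
    have := ((hasDerivAt_const t (-r)).div ((hasDerivAt_id t).const_mul 4)
      (by simpa using ht.ne')).exp
    refine this.congr_deriv ?_
    simp only [id]
    congr 1
    field_simp
    ring
  refine (h1.mul h2).congr_deriv ?_
  ring

variable {Sig Sp : Finset (E d)} [Fintype ↥(weylGroup Sig)]

lemma heatK_eq_sum (t : ℝ) (X Y : E d) : heatK Sig Sp t X Y =
    ((Fintype.card ↥(weylGroup Sig) : ℝ) * piP Sp X * piP Sp Y)⁻¹ *
      ∑ w : ↥(weylGroup Sig), dsign w.1 *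
        (((4 * Real.pi * t) ^ ((d : ℝ) / 2))⁻¹ * Real.exp (-‖X - w.1 Y‖ ^ 2 / (4 * t))) := by
  simp only [heatK, mul_left_comm (dsign _), ← mul_sum, mul_inv]
  ring

lemma deriv_heatK {t : ℝ} (ht : 0 < t) {X : E d} (hX : piP Sp X ≠ 0) (Y : E d) :
    deriv (fun s : ℝ => heatK Sig Sp s X Y) t =
      (piP Sp X)⁻¹ * lapl (fun Z => piP Sp Z * heatK Sig Sp t Z Y) X := by
  set P : ℝ := (4 * Real.pi * t) ^ ((d : ℝ) / 2) with hP
  set K : ℝ := ((Fintype.card ↥(weylGroup Sig) : ℝ) * piP Sp Y)⁻¹ with hK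
  have hev : (fun Z => piP Sp Z * heatK Sig Sp t Z Y) =ᶠ[𝓝 X] fun Z =>
      ∑ w : ↥(weylGroup Sig), K * P⁻¹ * dsign w.1 * Real.exp (-‖Z - w.1 Y‖ ^ 2 / (4 * t)) := by
    filter_upwards [(continuous_piP Sp).continuousAt.eventually_ne hX] with Z hZ
    simp only [mul_assoc, ← mul_sum]
    rw [heatK, ← hP, hK]
    simp only [mul_inv]
    field_simp
  have hl : lapl (fun Z => piP Sp Z * heatK Sig Sp t Z Y) X = lapl (fun Z =>
      ∑ w : ↥(weylGroup Sig), K * P⁻¹ * dsign w.1 * Real.exp (-‖Z - w.1 Y‖ ^ 2 / (4 * t))) X := by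
    refine sum_congr rfl fun i _ => ?_
    refine congrArg (fun L : E d →L[ℝ] ℝ => L (EuclideanSpace.single i 1)) ?_
    refine EventuallyEq.fderiv_eq ?_
    filter_upwards [hev.fderiv (𝕜 := ℝ)] with Z hZ
    rw [hZ]
  rw [hl, lapl_sum_gaussian]
  simp only [heatK_eq_sum]
  rw [((HasDerivAt.fun_sum fun (w : ↥(weylGroup Sig)) _ =>
    ((hasDerivAt_gaussian_time d (‖X - w.1 Y‖ ^ 2) ht).const_mul (dsign w.1))).const_mul _).deriv,
    mul_sum, mul_sum]
  refine sum_congr rfl fun w _ => ?_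
  rw [← hP, hK]
  simp only [mul_inv]
  ring

lemma integral_heatK_mul (hroot : IsRootSystem Sig) (hpos : IsPositiveSystem Sig Sp)
    {f : E d → ℝ} (hf : ∀ w : ↥(weylGroup Sig), ∀ Y : E d, f (w.1 Y) = f Y) {t : ℝ} {X : E d}
    (hint : Integrable fun Y => Real.exp (-‖X - Y‖ ^ 2 / (4 * t)) * (f Y * piP Sp Y)) :
    ∫ Y : E d, heatK Sig Sp t X Y * f Y * (piP Sp Y) ^ 2 =
      (piP Sp X)⁻¹ * (((4 * Real.pi * t) ^ ((d : ℝ) / 2))⁻¹ *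
        ∫ Y, Real.exp (-‖X - Y‖ ^ 2 / (4 * t)) * (f Y * piP Sp Y)) := by
  set F : E d → ℝ := fun Y => Real.exp (-‖X - Y‖ ^ 2 / (4 * t)) * (f Y * piP Sp Y) with hF
  set P : ℝ := (4 * Real.pi * t) ^ ((d : ℝ) / 2)
  have hpt : ∀ Y, heatK Sig Sp t X Y * f Y * (piP Sp Y) ^ 2 =
      ((Fintype.card ↥(weylGroup Sig) : ℝ) * P * piP Sp X)⁻¹ *
        ∑ w : ↥(weylGroup Sig), F (w.1 Y) := by
    intro Y
    have hw : ∀ w : ↥(weylGroup Sig), F (w.1 Y) =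
        dsign w.1 * Real.exp (-‖X - w.1 Y‖ ^ 2 / (4 * t)) * (f Y * piP Sp Y) := by
      intro w
      rw [hF]
      simp only [hf w, piP_weylGroup hroot hpos w.2]
      ring
    simp only [hw, ← sum_mul]
    have hpi : (piP Sp Y)⁻¹ * piP Sp Y ^ 2 = piP Sp Y := by
      by_cases h : piP Sp Y = 0
      · simp [h]
      · field_simp
    rw [heatK, mul_inv _ (piP Sp Y)]
    linear_combination ((Fintype.card ↥(weylGroup Sig) : ℝ) * P * piP Sp X)⁻¹ * f Y *
      (∑ w : ↥(weylGroup Sig), dsign w.1 * Real.exp (-‖X - w.1 Y‖ ^ 2 / (4 * t))) * hpi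
  have hmeas : ∀ w : ↥(weylGroup Sig), MeasurePreserving (w.1 : E d → E d) :=
    fun w => w.1.measurePreserving
  have hemb : ∀ w : ↥(weylGroup Sig), MeasurableEmbedding (w.1 : E d → E d) :=
    fun w => w.1.toHomeomorph.measurableEmbedding
  have hintw : ∀ w : ↥(weylGroup Sig), Integrable fun Y => F (w.1 Y) :=
    fun w => ((hmeas w).integrable_comp_emb (hemb w)).2 hint
  simp only [hpt]
  rw [integral_const_mul, integral_finsetSum _ fun w _ => hintw w]
  simp only [(hmeas _).integral_comp (hemb _)]
  have hcard : (Fintype.card ↥(weylGroup Sig) : ℝ) ≠ 0 := Nat.cast_ne_zero.2 Fintype.card_ne_zero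
  rw [sum_const, card_univ, nsmul_eq_mul]
  simp only [mul_inv]
  field_simp

end Analysis

/-- (i) For each fixed non-singular `Y`, `(t, X) ↦ p_t^W(X,Y)` satisfies the
`W`-invariant heat equation `∂_t p_t^W(X,Y) = π(X)⁻¹ Δ_X (π(·) p_t^W(·,Y))(X)` at every
`t > 0` and non-singular `X`; (ii) for every bounded continuous `W`-invariant `f` and
non-singular `X`, `∫ p_t^W(X,Y) f(Y) π(Y)² dY → f(X)` as `t → 0⁺`. -/
theorem stmt_6 (d : ℕ) (hd : 1 ≤ d) (Sig Sp : Finset (E d))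
    (hroot : IsRootSystem Sig) (hpos : IsPositiveSystem Sig Sp)
    [Fintype ↥(weylGroup Sig)] :
    (∀ Y : E d, (∀ α ∈ Sig, ⟪α, Y⟫ ≠ 0) → ∀ t : ℝ, 0 < t →
      ∀ X : E d, (∀ α ∈ Sig, ⟪α, X⟫ ≠ 0) →
        deriv (fun s : ℝ => heatK Sig Sp s X Y) t =
          (piP Sp X)⁻¹ * lapl (fun Z => piP Sp Z * heatK Sig Sp t Z Y) X) ∧
    (∀ f : E d → ℝ, Continuous f → (∃ C : ℝ, ∀ Y : E d, |f Y| ≤ C) →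
      (∀ w : ↥(weylGroup Sig), ∀ Y : E d, f (w.1 Y) = f Y) →
      ∀ X : E d, (∀ α ∈ Sig, ⟪α, X⟫ ≠ 0) →
        Filter.Tendsto (fun t : ℝ => ∫ Y : E d, heatK Sig Sp t X Y * f Y * (piP Sp Y) ^ 2)
          (nhdsWithin 0 (Set.Ioi 0)) (nhds (f X))) := by
  refine ⟨fun Y _ t ht X hX => deriv_heatK ht (hpos.piP_ne_zero hX) Y, ?_⟩
  rintro f hf ⟨C, hC⟩ hinv X hX
  obtain ⟨C', hC'⟩ := abs_piP_le Sp
  have hcont : Continuous fun Y => f Y * piP Sp Y := hf.mul (continuous_piP Sp)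
  have hbound : ∀ Y, |f Y * piP Sp Y| ≤ C * C' * Real.exp ‖Y‖ := fun Y => by
    rw [abs_mul, mul_assoc]
    exact mul_le_mul (hC Y) (hC' Y) (abs_nonneg _) ((abs_nonneg _).trans (hC Y))
  have hlim := (tendsto_integral_gaussian_mul hcont hbound X).const_mul (piP Sp X)⁻¹
  rw [mul_comm (f X), inv_mul_cancel_left₀ (hpos.piP_ne_zero hX)] at hlim
  refine hlim.congr' ?_
  filter_upwards [self_mem_nhdsWithin] with t ht
  exact (integral_heatK_mul hroot hpos hinv (integrable_gaussian_mul hcont hbound X ht)).symm
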